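/- Fix an integer k ≥ 2 and a constant c₀ > 0, and assume the following supersaturation hypothesis: for every finite simple bipartite graph H with vertex bipartition A₀ ⊔ B₀ and m₀ edges satisfying m₀ ≥ 100·k·(|A₀| + |B₀| + (|A₀|·|B₀|)^((k+1)/(2k))), the number of copies of C_{2k} in H is at least c₀·m₀^(2k)/(|A₀|^k·|B₀|^k). Then there is a constant C > 0 (depending only on k and c₀) such that the following holds. Let G be a finite simple graph with m edges, containing t copies of C_{2k}, with maximum degree Δ(G) ≤ m^(2/(k+1)). Fix a vertex subset A ⊆ V(G) and a positive integer d with d ≤ Δ(G), and let B be the set of vertices v ∈ V(G) with d/2 ≤ |N(v) ∩ A| ≤ d. Then d·√|B| ≤ C·(m^(1/(k+1)) + t^(1/(2k)))·√|A|. -/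

import Mathlib

open SimpleGraph

/-- The number of subgraphs of `G` isomorphic to the cycle on `n` vertices. -/
noncomputable def countCopiesOfCycle (n : ℕ) {V : Type*} (G : SimpleGraph V) : ℕ :=
  {H : G.Subgraph | Nonempty (H.coe ≃g cycleGraph n)}.ncard

/-- The unbalanced supersaturation hypothesis for `C_{2k}` with constant `c₀`. -/
def UnbalancedSupersat (k : ℕ) (c₀ : ℝ) : Prop :=
  ∀ (W : Type) [Fintype W] [DecidableEq W] (H : SimpleGraph W) [DecidableRel H.Adj]
    (A₀ B₀ : Finset W), Disjoint A₀ B₀ → A₀ ∪ B₀ = Finset.univ →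
    (∀ u v : W, H.Adj u v → (u ∈ A₀ ∧ v ∈ B₀) ∨ (u ∈ B₀ ∧ v ∈ A₀)) →
    (H.edgeFinset.card : ℝ) ≥ 100 * k * ((A₀.card : ℝ) + (B₀.card : ℝ) +
      ((A₀.card : ℝ) * (B₀.card : ℝ)) ^ (((k : ℝ) + 1) / (2 * (k : ℝ)))) →
    (countCopiesOfCycle (2 * k) H : ℝ) ≥
      c₀ * (H.edgeFinset.card : ℝ) ^ (2 * k) / ((A₀.card : ℝ) ^ k * (B₀.card : ℝ) ^ k)

open Finset in
/-- Every set of off-diagonal pairs has a vertex cut that separates, in the given direction, at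
least a quarter of the pairs. -/
theorem exists_cut_card_le {V : Type*} [Fintype V] [DecidableEq V] (P : Finset (V × V))
    (hP : ∀ p ∈ P, p.1 ≠ p.2) :
    ∃ X : Finset V, #P ≤ 4 * #{p ∈ P | p.1 ∈ X ∧ p.2 ∉ X} := by
  have key : ∀ p ∈ P,
      4 * #{X : Finset V | p.1 ∈ X ∧ p.2 ∉ X} = 2 ^ Fintype.card V := by
    intro p hp
    have hsub : ({p.1} : Finset V) ⊆ {p.2}ᶜ := by simpa using (hP p hp).symm
    have h : ({X : Finset V | p.1 ∈ X ∧ p.2 ∉ X} : Finset (Finset V)) = Icc {p.1} {p.2}ᶜ := by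
      ext X
      simp
    have h2 : 2 ≤ Fintype.card V := Fintype.one_lt_card_iff.2 ⟨p.1, p.2, hP p hp⟩
    rw [h, card_Icc_finset hsub, card_compl, card_singleton, card_singleton]
    obtain ⟨n, hn⟩ := Nat.exists_eq_add_of_le h2
    rw [hn, show 2 + n - 1 - 1 = n by omega, pow_add]
    norm_num
  have hsum : ∑ X : Finset V, 4 * #{p ∈ P | p.1 ∈ X ∧ p.2 ∉ X} = ∑ _X : Finset V, #P := by
    have h := sum_card_bipartiteAbove_eq_sum_card_bipartiteBelow
      (s := (univ : Finset (Finset V))) (t := P) (fun X p ↦ p.1 ∈ X ∧ p.2 ∉ X)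
    simp only [bipartiteAbove, bipartiteBelow] at h
    rw [← mul_sum, h, mul_sum, sum_congr rfl key]
    simp [mul_comm]
  obtain ⟨X, -, hX⟩ := exists_le_of_sum_le univ_nonempty hsum.ge
  exact ⟨X, hX⟩

theorem countCopiesOfCycle_le_of_copy {V W : Type*} [Finite V] {H : SimpleGraph W}
    {G : SimpleGraph V} (f : Copy H G) (n : ℕ) :
    countCopiesOfCycle n H ≤ countCopiesOfCycle n G := by
  refine Set.ncard_le_ncard_of_injOn (Subgraph.map f.toHom) ?_ ?_ (Set.toFinite _)
  · rintro S ⟨e⟩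
    exact ⟨(f.isoSubgraphMap S).symm.trans e⟩
  · intro S _ T _ h
    ext u v
    · have := congrArg (fun R ↦ f u ∈ R.verts) h
      simpa [show ∀ x, f x = f u ↔ x = u from fun _ ↦ f.injective.eq_iff] using this
    · have := congrArg (fun R ↦ R.Adj (f u) (f v)) h
      simpa [Relation.Map, show ∀ x y, f x = f y ↔ x = y from fun _ _ ↦ f.injective.eq_iff]
        using this

open Finset in
/-- Supersaturation applied to the edges of `G` between two disjoint vertex sets. -/
theorem UnbalancedSupersat.le_countCopiesOfCycle {k : ℕ} {c₀ : ℝ} (hyp : UnbalancedSupersat k c₀)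
    (hc₀ : 0 ≤ c₀) {V : Type} [Fintype V] [DecidableEq V] (G : SimpleGraph V) [DecidableRel G.Adj]
    {X Y : Finset V} (hXY : Disjoint X Y)
    (h : 100 * k * ((#X : ℝ) + #Y + ((#X : ℝ) * #Y) ^ (((k : ℝ) + 1) / (2 * k))) ≤
      #(G.interedges X Y)) :
    c₀ * (#(G.interedges X Y) : ℝ) ^ (2 * k) / ((#X : ℝ) ^ k * (#Y : ℝ) ^ k) ≤
      countCopiesOfCycle (2 * k) G := by
  classical
  let H : SimpleGraph {v // v ∈ X ∪ Y} :=
    { Adj := fun u v ↦ G.Adj u v ∧ ((u.1 ∈ X ∧ v.1 ∈ Y) ∨ (u.1 ∈ Y ∧ v.1 ∈ X))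
      symm := ⟨fun u v huv ↦ ⟨huv.1.symm, by tauto⟩⟩
      loopless := ⟨fun u hu ↦ G.loopless.irrefl u.1 hu.1⟩ }
  let f : Copy H G := ⟨⟨Subtype.val, fun huv ↦ huv.1⟩, Subtype.val_injective⟩
  have hX : #(X.subtype (· ∈ X ∪ Y)) = #X := by
    rw [card_subtype, filter_true_of_mem fun v hv ↦ mem_union_left _ hv]
  have hY : #(Y.subtype (· ∈ X ∪ Y)) = #Y := by
    rw [card_subtype, filter_true_of_mem fun v hv ↦ mem_union_right _ hv]
  have hcard : #(G.interedges X Y) ≤ #H.edgeFinset := by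
    calc #(G.interedges X Y) = #((G.interedges X Y).image fun p ↦ s(p.1, p.2)) := by
          refine (card_image_of_injOn ?_).symm
          rintro ⟨a, b⟩ hab ⟨c, d⟩ hcd heq
          simp only [mem_coe, mem_interedges_iff] at hab hcd
          rcases Sym2.eq_iff.1 heq with ⟨rfl, rfl⟩ | ⟨rfl, rfl⟩
          · rfl
          · exact (Finset.disjoint_left.1 hXY hab.1 hcd.2.1).elim
      _ ≤ #(H.edgeFinset.image (Sym2.map Subtype.val)) := by
          refine card_le_card fun e he ↦ ?_
          obtain ⟨⟨a, b⟩, hab, rfl⟩ := mem_image.1 he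
          rw [mem_interedges_iff] at hab
          refine mem_image.2 ⟨s(⟨a, mem_union_left _ hab.1⟩, ⟨b, mem_union_right _ hab.2.1⟩), ?_, rfl⟩
          rw [mem_edgeFinset, mem_edgeSet]
          exact ⟨hab.2.2, Or.inl ⟨hab.1, hab.2.1⟩⟩
      _ ≤ #H.edgeFinset := card_image_le
  have hcard' : (#(G.interedges X Y) : ℝ) ≤ #H.edgeFinset := by exact_mod_cast hcard
  have main := hyp _ H (X.subtype (· ∈ X ∪ Y)) (Y.subtype (· ∈ X ∪ Y))
    (by
      rw [Finset.disjoint_left]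
      intro v hv hv'
      exact Finset.disjoint_left.1 hXY (mem_subtype.1 hv) (mem_subtype.1 hv'))
    (by
      ext v
      simpa only [mem_union, mem_subtype, mem_univ, iff_true] using mem_union.1 v.2)
    (by
      intro u v huv
      simpa only [mem_subtype] using huv.2)
    (by rw [hX, hY]; exact h.trans hcard')
  rw [hX, hY] at main
  calc _ ≤ c₀ * (#H.edgeFinset : ℝ) ^ (2 * k) / ((#X : ℝ) ^ k * (#Y : ℝ) ^ k) := by gcongr
    _ ≤ countCopiesOfCycle (2 * k) H := main
    _ ≤ countCopiesOfCycle (2 * k) G := by exact_mod_cast countCopiesOfCycle_le_of_copy f _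

/-- The numerical estimate when supersaturation fails. -/
theorem sq_mul_le_of_lt_supersat {k : ℕ} (hk : 2 ≤ k) {d a b m : ℝ} (hd : 0 < d) (ha : 0 < a)
    (hb : 0 < b) (hm : 0 ≤ m) (hdm : d ≤ m ^ (2 / ((k : ℝ) + 1)))
    (hdb : d * b ≤ 4 * m) (hda : d * b ≤ 2 * a * m ^ (2 / ((k : ℝ) + 1)))
    (hlt : d * b / 8 ≤ 100 * k * (a + b + (a * b) ^ (((k : ℝ) + 1) / (2 * k)))) :
    d ^ 2 * b ≤ 16 * (2400 * k) ^ (2 * k) * m ^ (2 / ((k : ℝ) + 1)) * a := by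
  have hk' : (2 : ℝ) ≤ k := by exact_mod_cast hk
  set K : ℝ := 2400 * k with hK
  set M : ℝ := m ^ (2 / ((k : ℝ) + 1)) with hM
  set r : ℝ := (a * b) ^ (((k : ℝ) + 1) / (2 * k)) with hr
  have hK1 : 1 ≤ K := by rw [hK]; linarith
  have hKpow : K ≤ K ^ (2 * k) := le_self_pow₀ hK1 (by omega)
  have hM0 : 0 < M := hd.trans_le hdm
  have hsum : d * b ≤ K * a ∨ d * b ≤ K * b ∨ d * b ≤ K * r := by
    by_contra! hcon
    have : K * a + K * b + K * r < 3 * (d * b) := by linarith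
    have : d * b ≤ (K * a + K * b + K * r) / 3 := by rw [hK]; linarith
    linarith
  have hL : 2 * K ≤ 16 * K ^ (2 * k) := by linarith
  rcases hsum with h | h | h
  · calc d ^ 2 * b = d * (d * b) := by ring
      _ ≤ M * (K * a) := by gcongr
      _ = K * (M * a) := by ring
      _ ≤ 16 * K ^ (2 * k) * (M * a) := by gcongr; linarith
      _ = _ := by ring
  · have h' : d ≤ K := le_of_mul_le_mul_right h hb
    calc d ^ 2 * b = d * (d * b) := by ring
      _ ≤ K * (2 * a * M) := by gcongr
      _ = 2 * K * (M * a) := by ring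
      _ ≤ 16 * K ^ (2 * k) * (M * a) := by gcongr
      _ = _ := by ring
  · have hrpow : r ^ (2 * k) = (a * b) ^ (k + 1) := by
      rw [hr, ← Real.rpow_mul_natCast (by positivity), ← Real.rpow_natCast]
      congr 1
      push_cast
      field_simp
    have hMpow : M ^ (k + 1) = m ^ 2 := by
      rw [hM, ← Real.rpow_mul_natCast hm, ← Real.rpow_natCast m 2]
      congr 1
      push_cast
      field_simp
    have h1 : (d * b) ^ (2 * k) ≤ K ^ (2 * k) * (a * b) ^ (k + 1) := by
      rw [← hrpow, ← mul_pow]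
      gcongr
    have h2 : (d ^ 2 * b) ^ (k + 1) * b ^ (k + 1) ≤
        (16 * K ^ (2 * k) * M * a) ^ (k + 1) * b ^ (k + 1) := by
      calc (d ^ 2 * b) ^ (k + 1) * b ^ (k + 1) = (d * b) ^ (2 * k) * (d * b) ^ 2 := by ring
        _ ≤ (K ^ (2 * k) * (a * b) ^ (k + 1)) * (4 * m) ^ 2 := by gcongr
        _ = (16 * K ^ (2 * k)) * (M ^ (k + 1) * a ^ (k + 1) * b ^ (k + 1)) := by
            rw [hMpow, mul_pow]; ring
        _ ≤ (16 * K ^ (2 * k)) ^ (k + 1) * (M ^ (k + 1) * a ^ (k + 1) * b ^ (k + 1)) := by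
            gcongr
            exact le_self_pow₀ (by linarith) (by omega)
        _ = _ := by rw [mul_pow _ a, mul_pow _ M]; ring
    exact le_of_pow_le_pow_left₀ (by omega) (by positivity)
      (le_of_mul_le_mul_right h2 (by positivity))

/-- The numerical estimate when supersaturation holds. -/
theorem mul_sqrt_le_of_supersat {k : ℕ} (hk : 2 ≤ k) {c₀ d a b e x y t : ℝ} (hc₀ : 0 < c₀)
    (hd : 0 < d) (hb : 0 < b) (hx : 0 < x) (hy : 0 < y) (hxa : x ≤ a) (hyb : y ≤ b)
    (he : d * b / 8 ≤ e) (ht : c₀ * e ^ (2 * k) / (x ^ k * y ^ k) ≤ t) :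
    d * √b ≤ 8 / min 1 c₀ * t ^ (1 / (2 * (k : ℝ))) * √a := by
  have hk' : (2 : ℝ) ≤ k := by exact_mod_cast hk
  have ha : 0 < a := hx.trans_le hxa
  have he0 : 0 ≤ e := le_trans (by positivity) he
  set c := min 1 c₀ with hc
  have hc0 : 0 < c := lt_min one_pos hc₀
  have hcpow : c ^ (2 * k) ≤ c₀ :=
    (pow_le_of_le_one hc0.le (min_le_left _ _) (by omega)).trans (min_le_right _ _)
  have ht0 : 0 ≤ t := le_trans (by positivity) ht
  have hT : (t ^ (1 / (2 * (k : ℝ)))) ^ (2 * k) = t := by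
    rw [← Real.rpow_mul_natCast ht0]
    push_cast
    rw [one_div_mul_cancel (by positivity), Real.rpow_one]
  have hsa : √a ^ (2 * k) = a ^ k := by rw [pow_mul, Real.sq_sqrt ha.le]
  have hsb : √b ^ (2 * k) = b ^ k := by rw [pow_mul, Real.sq_sqrt hb.le]
  have h1 : c₀ * (d * b / 8) ^ (2 * k) / (a ^ k * b ^ k) ≤ t := by
    refine le_trans ?_ ht
    gcongr
  have h2 : (c * (d * √b)) ^ (2 * k) ≤ (8 * t ^ (1 / (2 * (k : ℝ))) * √a) ^ (2 * k) := by
    rw [div_le_iff₀ (by positivity), div_pow, mul_div_assoc', div_le_iff₀ (by positivity)] at h1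
    simp only [mul_pow, hT, hsa, hsb] at h1 ⊢
    refine le_of_mul_le_mul_right ?_ (pow_pos hb k)
    calc c ^ (2 * k) * (d ^ (2 * k) * b ^ k) * b ^ k = c ^ (2 * k) * (d ^ (2 * k) * b ^ (2 * k)) := by
          ring
      _ ≤ c₀ * (d ^ (2 * k) * b ^ (2 * k)) := by gcongr
      _ ≤ _ := h1
      _ = _ := by ring
  have h3 := le_of_pow_le_pow_left₀ (by omega) (by positivity) h2
  rw [div_mul_eq_mul_div, div_mul_eq_mul_div, le_div_iff₀ hc0]
  linarith

namespace SimpleGraph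

open Finset

variable {V : Type*} (G : SimpleGraph V) [DecidableRel G.Adj]

theorem card_interedges_comm (A B : Finset V) :
    #(G.interedges A B) = #(G.interedges B A) :=
  haveI : Std.Symm G.Adj := G.symm
  Rel.card_interedges_comm A B

variable [Fintype V] [DecidableEq V]

theorem card_interedges_eq_sum (A B : Finset V) :
    #(G.interedges A B) = ∑ v ∈ B, #(G.neighborFinset v ∩ A) := by
  rw [G.card_interedges_comm, card_eq_sum_card_fiberwise (f := Prod.fst) (t := B)
    fun p hp ↦ ((G.mem_interedges_iff).1 hp).1]
  refine sum_congr rfl fun v hv ↦ ?_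
  refine card_bij' (fun p _ ↦ p.2) (fun w _ ↦ (v, w)) ?_ ?_ ?_ ?_ <;>
    simp +contextual [mem_interedges_iff, hv]
  all_goals grind

theorem card_interedges_le_sum_degree (A B : Finset V) :
    #(G.interedges A B) ≤ ∑ v ∈ B, G.degree v := by
  rw [card_interedges_eq_sum]
  exact sum_le_sum fun v _ ↦ card_le_card inter_subset_left

theorem card_interedges_le_two_mul_card_edgeFinset (A B : Finset V) :
    #(G.interedges A B) ≤ 2 * #G.edgeFinset := by
  rw [← G.sum_degrees_eq_twice_card_edges]
  exact (G.card_interedges_le_sum_degree A B).trans (sum_le_sum_of_subset (subset_univ B))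

theorem card_interedges_le_card_mul_maxDegree (A B : Finset V) :
    #(G.interedges A B) ≤ #A * G.maxDegree := by
  rw [G.card_interedges_comm, ← smul_eq_mul, ← sum_const]
  exact (G.card_interedges_le_sum_degree B A).trans
    (sum_le_sum fun v _ ↦ G.degree_le_maxDegree v)

end SimpleGraph

/-- Under the unbalanced supersaturation hypothesis, the key degree-regularity lemma
with an additional `t^(1/(2k))` term: `d·√|B| ≤ C·(m^(1/(k+1)) + t^(1/(2k)))·√|A|`. -/
theorem key_lemma_of_supersat (k : ℕ) (hk : 2 ≤ k) (c₀ : ℝ) (hc₀ : 0 < c₀)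
    (hyp : UnbalancedSupersat k c₀) :
    ∃ C : ℝ, 0 < C ∧
      ∀ (V : Type) [Fintype V] [DecidableEq V] (G : SimpleGraph V) [DecidableRel G.Adj],
        (G.maxDegree : ℝ) ≤ (G.edgeFinset.card : ℝ) ^ (2 / ((k : ℝ) + 1)) →
        ∀ (A : Finset V) (d : ℕ), 0 < d → d ≤ G.maxDegree →
          (d : ℝ) * Real.sqrt
              (({v : V | (d : ℝ) / 2 ≤ ((G.neighborFinset v ∩ A).card : ℝ) ∧
                  (G.neighborFinset v ∩ A).card ≤ d}).ncard) ≤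
            C * ((G.edgeFinset.card : ℝ) ^ (1 / ((k : ℝ) + 1)) +
                (countCopiesOfCycle (2 * k) G : ℝ) ^ (1 / (2 * (k : ℝ)))) *
              Real.sqrt (A.card) := by
  have hk' : (2 : ℝ) ≤ k := by exact_mod_cast hk
  set L : ℝ := 16 * (2400 * (k : ℝ)) ^ (2 * k) with hL
  have hc : 0 < min 1 c₀ := lt_min one_pos hc₀
  refine ⟨√L + 8 / min 1 c₀, by positivity, ?_⟩
  intro V _ _ G _ hΔ A d hd hdΔ
  set B : Finset V := {v | (d : ℝ) / 2 ≤ ((G.neighborFinset v ∩ A).card : ℝ) ∧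
    (G.neighborFinset v ∩ A).card ≤ d} with hB
  have hBcard : ({v : V | (d : ℝ) / 2 ≤ ((G.neighborFinset v ∩ A).card : ℝ) ∧
      (G.neighborFinset v ∩ A).card ≤ d}).ncard = B.card := by
    rw [← Set.ncard_coe_finset, hB]
    simp
  rw [hBcard]
  rcases B.eq_empty_or_nonempty with hB0 | hB0
  · simp only [hB0, Finset.card_empty, Nat.cast_zero, Real.sqrt_zero, mul_zero]
    positivity
  set m : ℝ := (G.edgeFinset.card : ℝ) with hm
  set t : ℝ := (countCopiesOfCycle (2 * k) G : ℝ) with ht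
  have hd' : (0 : ℝ) < d := by exact_mod_cast hd
  have hb : (0 : ℝ) < B.card := by exact_mod_cast hB0.card_pos
  have hP : (d : ℝ) * B.card / 2 ≤ (G.interedges A B).card := by
    rw [G.card_interedges_eq_sum]
    push_cast
    calc (d : ℝ) * B.card / 2 = ∑ _v ∈ B, (d : ℝ) / 2 := by simp; ring
      _ ≤ _ := Finset.sum_le_sum fun v hv ↦ (Finset.mem_filter.1 hv).2.1
  obtain ⟨S, hS⟩ := exists_cut_card_le (G.interedges A B)
    fun p hp ↦ (G.mem_interedges_iff.1 hp).2.2.ne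
  have hcut : (G.interedges A B).filter (fun p ↦ p.1 ∈ S ∧ p.2 ∉ S) ⊆
      G.interedges (A ∩ S) (B \ S) := by
    intro p hp
    simp only [Finset.mem_filter, mem_interedges_iff, Finset.mem_inter, Finset.mem_sdiff] at hp ⊢
    tauto
  have hdisj : Disjoint (A ∩ S) (B \ S) :=
    Finset.disjoint_sdiff.mono_left Finset.inter_subset_right
  have he : (d : ℝ) * B.card / 8 ≤ (G.interedges (A ∩ S) (B \ S)).card := by
    have h : ((G.interedges A B).card : ℝ) ≤ 4 * (G.interedges (A ∩ S) (B \ S)).card := by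
      exact_mod_cast hS.trans (Nat.mul_le_mul_left 4 (Finset.card_le_card hcut))
    linarith
  have hepos : (0 : ℝ) < (G.interedges (A ∩ S) (B \ S)).card := lt_of_lt_of_le (by positivity) he
  obtain ⟨p, hp⟩ := Finset.card_pos.1 (Nat.cast_pos.1 hepos)
  rw [mem_interedges_iff] at hp
  have hx : (0 : ℝ) < (A ∩ S).card := by exact_mod_cast Finset.card_pos.2 ⟨_, hp.1⟩
  have hy : (0 : ℝ) < (B \ S).card := by exact_mod_cast Finset.card_pos.2 ⟨_, hp.2.1⟩
  have hxa : ((A ∩ S).card : ℝ) ≤ A.card := by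
    exact_mod_cast Finset.card_le_card Finset.inter_subset_left
  have hyb : ((B \ S).card : ℝ) ≤ B.card := by
    exact_mod_cast Finset.card_le_card Finset.sdiff_subset
  have ha : (0 : ℝ) < A.card := hx.trans_le hxa
  have hm0 : (0 : ℝ) ≤ m := Nat.cast_nonneg _
  by_cases hcase : 100 * (k : ℝ) * (((A ∩ S).card : ℝ) + (B \ S).card +
      (((A ∩ S).card : ℝ) * (B \ S).card) ^ (((k : ℝ) + 1) / (2 * k))) ≤
      (G.interedges (A ∩ S) (B \ S)).card
  · have h := mul_sqrt_le_of_supersat hk hc₀ hd' hb hx hy hxa hyb he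
      (hyp.le_countCopiesOfCycle hc₀.le G hdisj hcase)
    refine h.trans ?_
    have hm1 : 0 ≤ m ^ (1 / ((k : ℝ) + 1)) := by positivity
    gcongr
    · exact le_add_of_nonneg_left (Real.sqrt_nonneg L)
    · exact le_add_of_nonneg_left hm1
  · have hΔ' : (d : ℝ) ≤ m ^ (2 / ((k : ℝ) + 1)) := le_trans (by exact_mod_cast hdΔ) hΔ
    have hP2 : ((G.interedges A B).card : ℝ) ≤ 2 * m := by
      rw [hm]
      exact_mod_cast G.card_interedges_le_two_mul_card_edgeFinset A B
    have hPΔ : ((G.interedges A B).card : ℝ) ≤ A.card * m ^ (2 / ((k : ℝ) + 1)) := by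
      refine le_trans (b := (A.card : ℝ) * G.maxDegree) ?_ (by gcongr)
      exact_mod_cast G.card_interedges_le_card_mul_maxDegree A B
    have h := sq_mul_le_of_lt_supersat hk hd' ha hb hm0 hΔ' (by linarith) (by linarith) (by
      refine he.trans ((not_le.1 hcase).le.trans ?_)
      gcongr)
    have hMsq : m ^ (2 / ((k : ℝ) + 1)) = (m ^ (1 / ((k : ℝ) + 1))) ^ 2 := by
      rw [← Real.rpow_mul_natCast hm0]
      congr 1
      push_cast
      ring
    have hm1 : 0 ≤ m ^ (1 / ((k : ℝ) + 1)) := by positivity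
    have ht1 : 0 ≤ t ^ (1 / (2 * (k : ℝ))) := Real.rpow_nonneg (Nat.cast_nonneg _) _
    calc (d : ℝ) * √(B.card) = √((d : ℝ) ^ 2 * B.card) := by
          rw [Real.sqrt_mul (by positivity), Real.sqrt_sq hd'.le]
      _ ≤ √(L * m ^ (2 / ((k : ℝ) + 1)) * A.card) := Real.sqrt_le_sqrt h
      _ = √L * m ^ (1 / ((k : ℝ) + 1)) * √(A.card) := by
          rw [Real.sqrt_mul (by positivity), Real.sqrt_mul (by positivity), hMsq, Real.sqrt_sq hm1]
      _ ≤ _ := by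
          gcongr
          · exact le_add_of_nonneg_right (by positivity)
          · exact le_add_of_nonneg_right ht1
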